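/- Let A be a finite set of integers with |A| ≥ 5 whose elements attain exactly 3 distinct residues modulo 4, with residue classes A₁, A₂, A₃ ordered so that |A₁| ≥ |A₂| ≥ |A₃|. If |A₃| ≤ 4, then |A + 4·A| ≥ 5|A| − 6. -/

import Mathlib

open Finset Pointwise


set_option maxHeartbeats 1000000 in
theorem arith_full (b0 b1 b2 b3 x y z c0 c1 c2 c3 : ℕ) (hx : 1 ≤ x) (hy : 1 ≤ y) (hz : 1 ≤ z) (e0 : 1 ≤ b0) (e1 : 1 ≤ b1) (e2 : 1 ≤ b2) (e3 : 1 ≤ b3)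
    (hn : 5 ≤ x + y + z) (hm : x ≤ 4 ∨ y ≤ 4 ∨ z ≤ 4)
    (ht : b0+b1+b2+b3 = x ∨ b0+b1+b2+b3 = y ∨ b0+b1+b2+b3 = z)
    (h00 : 1 ≤ b0 → b0 + x ≤ c0 + 1) (h01 : 1 ≤ b0 → b0 + y ≤ c1 + 1) (h02 : 1 ≤ b0 → b0 + z ≤ c2 + 1)
    (h10 : 1 ≤ b1 → b1 + x ≤ c1 + 1) (h11 : 1 ≤ b1 → b1 + y ≤ c2 + 1) (h12 : 1 ≤ b1 → b1 + z ≤ c3 + 1)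
    (h20 : 1 ≤ b2 → b2 + x ≤ c2 + 1) (h21 : 1 ≤ b2 → b2 + y ≤ c3 + 1) (h22 : 1 ≤ b2 → b2 + z ≤ c0 + 1)
    (h30 : 1 ≤ b3 → b3 + x ≤ c3 + 1) (h31 : 1 ≤ b3 → b3 + y ≤ c0 + 1) (h32 : 1 ≤ b3 → b3 + z ≤ c1 + 1)
    (s0 : 1 ≤ b0 → b0 = b2 → x = z → 2 * (b0 + x) ≤ c0 + c2 + 1)
    (s1 : 1 ≤ b1 → b1 = b3 → x = z → 2 * (b1 + x) ≤ c1 + c3 + 1)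
    (y0 : b0 = 1 → b1 = 1 → b2 = 1 → b3 = 1 → x = y → 4 * x + 1 ≤ c0 + c1 + c2 + c3)
    (y1 : b0 = 1 → b1 = 1 → b2 = 1 → b3 = 1 → y = z → 4 * y + 1 ≤ c0 + c1 + c2 + c3) :
    x + y + z + 2 * (b0+b1+b2+b3) ≤ c0 + c1 + c2 + c3 + 2 := by
  replace h00 := h00 e0; replace h01 := h01 e0; replace h02 := h02 e0
  replace h10 := h10 e1; replace h11 := h11 e1; replace h12 := h12 e1
  replace h20 := h20 e2; replace h21 := h21 e2; replace h22 := h22 e2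
  replace h30 := h30 e3; replace h31 := h31 e3; replace h32 := h32 e3
  have k0 : (b0+b1+b2+b3) + 4 * x ≤ c0 + c1 + c2 + c3 + 4 := by linarith only [h00,h01,h02,h10,h11,h12,h20,h21,h22,h30,h31,h32]
  have k1 : (b0+b1+b2+b3) + 4 * y ≤ c0 + c1 + c2 + c3 + 4 := by linarith only [h00,h01,h02,h10,h11,h12,h20,h21,h22,h30,h31,h32]
  have k2 : (b0+b1+b2+b3) + 4 * z ≤ c0 + c1 + c2 + c3 + 4 := by linarith only [h00,h01,h02,h10,h11,h12,h20,h21,h22,h30,h31,h32]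
  by_contra hc
  have ht4 : 4 ≤ b0+b1+b2+b3 := by linarith only [e0,e1,e2,e3]
  have hbd : (x ≤ 5 ∧ y ≤ 5 ∧ z ≤ 5) ∧ 3 ≤ x ∧ 3 ≤ y ∧ 3 ≤ z := by
    clear h00 h01 h02 h10 h11 h12 h20 h21 h22 h30 h31 h32 s0 s1 y0 y1 e0 e1 e2 e3
    generalize b0+b1+b2+b3 = t at *
    generalize c0+c1+c2+c3 = c at *
    omega
  obtain ⟨⟨_, _, _⟩, _, _, _⟩ := hbd
  have ht5 : b0+b1+b2+b3 ≤ 5 := by rcases ht with h | h | h <;> rw [h] <;> assumption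
  have b0u : b0 ≤ 2 := by linarith only [ht5, e1, e2, e3]
  have b1u : b1 ≤ 2 := by linarith only [ht5, e0, e2, e3]
  have b2u : b2 ≤ 2 := by linarith only [ht5, e1, e0, e3]
  have b3u : b3 ≤ 2 := by linarith only [ht5, e1, e2, e0]
  clear hn hx hy hz
  have hcase : (x = 4 ∧ y = 4 ∧ z = 4) ∨ (x = 3 ∧ y = 4 ∧ z = 4) ∨ (x = 4 ∧ y = 3 ∧ z = 4) ∨
      (x = 4 ∧ y = 4 ∧ z = 3) ∨ (x = 4 ∧ y = 5 ∧ z = 5) ∨ (x = 5 ∧ y = 4 ∧ z = 5) ∨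
      (x = 5 ∧ y = 5 ∧ z = 4) := by
    clear h00 h01 h02 h10 h11 h12 h20 h21 h22 h30 h31 h32 s0 s1 y0 y1 e0 e1 e2 e3 b0u b1u b2u b3u
    generalize b0+b1+b2+b3 = t at *
    generalize c0+c1+c2+c3 = c at *
    interval_cases x <;> interval_cases y <;> omega
  rcases hcase with ⟨rfl, rfl, rfl⟩ | ⟨rfl, rfl, rfl⟩ | ⟨rfl, rfl, rfl⟩ | ⟨rfl, rfl, rfl⟩ |
    ⟨rfl, rfl, rfl⟩ | ⟨rfl, rfl, rfl⟩ | ⟨rfl, rfl, rfl⟩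
  iterate 4
    · have ht4' : b0+b1+b2+b3 = 4 := by rcases ht with h | h | h <;> linarith only [h, ht4]
      obtain rfl : b0 = 1 := by linarith only [ht4', e0, e1, e2, e3]
      obtain rfl : b1 = 1 := by linarith only [ht4', e0, e1, e2, e3]
      obtain rfl : b2 = 1 := by linarith only [ht4', e0, e1, e2, e3]
      obtain rfl : b3 = 1 := by linarith only [ht4', e0, e1, e2, e3]
      clear ht
      simp at y0 y1 s0 s1
      omega
  all_goals
    have hb : (b0 = 2 ∧ b1 = 1 ∧ b2 = 1 ∧ b3 = 1) ∨ (b0 = 1 ∧ b1 = 2 ∧ b2 = 1 ∧ b3 = 1) ∨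
        (b0 = 1 ∧ b1 = 1 ∧ b2 = 2 ∧ b3 = 1) ∨ (b0 = 1 ∧ b1 = 1 ∧ b2 = 1 ∧ b3 = 2) := by
      have ht5' : b0+b1+b2+b3 = 5 := by
        clear h00 h01 h02 h10 h11 h12 h20 h21 h22 h30 h31 h32 s0 s1 y0 y1 e0 e1 e2 e3 b0u b1u b2u b3u
        generalize b0+b1+b2+b3 = t at *
        generalize c0+c1+c2+c3 = c at *
        omega
      clear h00 h01 h02 h10 h11 h12 h20 h21 h22 h30 h31 h32 s0 s1 y0 y1 hc k0 k1 k2 ht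
      omega
    clear s0 s1 y0 y1 ht
    rcases hb with ⟨rfl, rfl, rfl, rfl⟩ | ⟨rfl, rfl, rfl, rfl⟩ | ⟨rfl, rfl, rfl, rfl⟩ |
      ⟨rfl, rfl, rfl, rfl⟩ <;> omega

set_option maxHeartbeats 4000000 in
theorem arith_all (b0 b1 b2 b3 x y z c0 c1 c2 c3 : ℕ) (hx : 1 ≤ x) (hy : 1 ≤ y) (hz : 1 ≤ z)
    (hn : 5 ≤ x + y + z) (hm : x ≤ 4 ∨ y ≤ 4 ∨ z ≤ 4)
    (ht : b0+b1+b2+b3 = x ∨ b0+b1+b2+b3 = y ∨ b0+b1+b2+b3 = z)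
    (h00 : 1 ≤ b0 → b0 + x ≤ c0 + 1) (h01 : 1 ≤ b0 → b0 + y ≤ c1 + 1) (h02 : 1 ≤ b0 → b0 + z ≤ c2 + 1)
    (h10 : 1 ≤ b1 → b1 + x ≤ c1 + 1) (h11 : 1 ≤ b1 → b1 + y ≤ c2 + 1) (h12 : 1 ≤ b1 → b1 + z ≤ c3 + 1)
    (h20 : 1 ≤ b2 → b2 + x ≤ c2 + 1) (h21 : 1 ≤ b2 → b2 + y ≤ c3 + 1) (h22 : 1 ≤ b2 → b2 + z ≤ c0 + 1)
    (h30 : 1 ≤ b3 → b3 + x ≤ c3 + 1) (h31 : 1 ≤ b3 → b3 + y ≤ c0 + 1) (h32 : 1 ≤ b3 → b3 + z ≤ c1 + 1)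
    (s0 : 1 ≤ b0 → b0 = b2 → x = z → 2 * (b0 + x) ≤ c0 + c2 + 1)
    (s1 : 1 ≤ b1 → b1 = b3 → x = z → 2 * (b1 + x) ≤ c1 + c3 + 1)
    (y0 : b0 = 1 → b1 = 1 → b2 = 1 → b3 = 1 → x = y → 4 * x + 1 ≤ c0 + c1 + c2 + c3)
    (y1 : b0 = 1 → b1 = 1 → b2 = 1 → b3 = 1 → y = z → 4 * y + 1 ≤ c0 + c1 + c2 + c3) :
    x + y + z + 2 * (b0+b1+b2+b3) ≤ c0 + c1 + c2 + c3 + 2 := by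
  by_cases hf : 1 ≤ b0 ∧ 1 ≤ b1 ∧ 1 ≤ b2 ∧ 1 ≤ b3
  · obtain ⟨e0, e1, e2, e3⟩ := hf
    exact arith_full b0 b1 b2 b3 x y z c0 c1 c2 c3 hx hy hz e0 e1 e2 e3 hn hm ht h00 h01 h02
      h10 h11 h12 h20 h21 h22 h30 h31 h32 s0 s1 y0 y1
  clear y0 y1
  rcases Nat.eq_zero_or_pos b0 with e0 | e0 <;> rcases Nat.eq_zero_or_pos b1 with e1 | e1 <;>
  rcases Nat.eq_zero_or_pos b2 with e2 | e2 <;> rcases Nat.eq_zero_or_pos b3 with e3 | e3 <;>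
  first
  | (exfalso; exact hf (And.intro e0 (And.intro e1 (And.intro e2 e3))); done)
  | (clear hf
     simp only [Nat.succ_le_iff, e0, e1, e2, e3, true_imp_iff, lt_self_iff_false, false_imp_iff]
       at h00 h01 h02 h10 h11 h12 h20 h21 h22 h30 h31 h32 s0 s1
     omega)

/-- elements of `X` congruent to `c` mod 4 -/
def cls (X : Finset ℤ) (c : ℤ) : Finset ℤ := X.filter (fun a => a % 4 = c)

theorem mem_cls {X : Finset ℤ} {c a : ℤ} : a ∈ cls X c ↔ a ∈ X ∧ a % 4 = c := by
  simp [cls]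

theorem card_cls (X : Finset ℤ) :
    (cls X 0).card + (cls X 1).card + (cls X 2).card + (cls X 3).card = X.card := by
  have h := Finset.card_eq_sum_card_fiberwise (f := fun a : ℤ => a % 4) (s := X)
    (t := ({0, 1, 2, 3} : Finset ℤ)) (by
      intro a _
      simp only [Finset.coe_insert, Finset.coe_singleton, Set.mem_insert_iff, Set.mem_singleton_iff]
      omega)
  rw [h]
  simp [cls]
  ring

theorem cls_add_subset (B A : Finset ℤ) (s j c : ℤ) (h : (s + j) % 4 = c) :
    cls B s + cls A j ⊆ cls (B + A) c := by
  intro x hx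
  obtain ⟨b, hb, a, ha, rfl⟩ := Finset.mem_add.1 hx
  rw [mem_cls] at *
  exact ⟨Finset.add_mem_add hb.1 ha.1, by omega⟩

theorem card_add_lower {S T : Finset ℤ} (hS : S.Nonempty) (hT : T.Nonempty) :
    S.card + T.card ≤ (S + T).card + 1 := by
  have := cauchy_davenport_add_of_linearOrder_isCancelAdd hS hT
  omega

theorem cls_lower (B A : Finset ℤ) (s j c : ℤ) (h : (s + j) % 4 = c)
    (hA : 1 ≤ (cls A j).card) (hB : 1 ≤ (cls B s).card) :
    (cls B s).card + (cls A j).card ≤ (cls (B + A) c).card + 1 :=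
  (card_add_lower (Finset.card_pos.1 hB) (Finset.card_pos.1 hA)).trans
    (Nat.succ_le_succ (Finset.card_le_card (cls_add_subset B A s j c h)))

/-- if a class of the sumset has minimal size, it equals each of the sums it contains -/
theorem cls_eq (B A : Finset ℤ) (s j c : ℤ) (h : (s + j) % 4 = c)
    (hA : 1 ≤ (cls A j).card) (hB : 1 ≤ (cls B s).card)
    (hc : (cls (B + A) c).card + 1 ≤ (cls B s).card + (cls A j).card) :
    cls B s + cls A j = cls (B + A) c := by
  apply Finset.eq_of_subset_of_card_le (cls_add_subset B A s j c h)
  have := card_add_lower (Finset.card_pos.1 hB) (Finset.card_pos.1 hA)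
  omega

theorem min_add_le {S T U V : Finset ℤ} (hS : S.Nonempty) (hT : T.Nonempty) (hU : U.Nonempty)
    (hV : V.Nonempty) (h : S + T = U + V) :
    S.min' hS + T.min' hT ≤ U.min' hU + V.min' hV := by
  have : U.min' hU + V.min' hV ∈ S + T :=
    h ▸ Finset.add_mem_add (Finset.min'_mem _ _) (Finset.min'_mem _ _)
  obtain ⟨s, hs, t, ht, e⟩ := Finset.mem_add.1 this
  rw [← e]
  exact add_le_add (Finset.min'_le _ _ hs) (Finset.min'_le _ _ ht)

theorem min_add_eq {S T U V : Finset ℤ} (hS : S.Nonempty) (hT : T.Nonempty) (hU : U.Nonempty)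
    (hV : V.Nonempty) (h : S + T = U + V) :
    S.min' hS + T.min' hT = U.min' hU + V.min' hV :=
  le_antisymm (min_add_le _ _ _ _ h) (min_add_le _ _ _ _ h.symm)

theorem min_mod {X : Finset ℤ} {c : ℤ} (h : (cls X c).Nonempty) : (cls X c).min' h % 4 = c :=
  (mem_cls.1 (Finset.min'_mem _ h)).2

theorem swap_lower (B A : Finset ℤ) (s t c d : ℤ) (hst : s ≠ t)
    (h1 : (s + 0) % 4 = c) (h2 : (t + 2) % 4 = c) (h3 : (s + 2) % 4 = d) (h4 : (t + 0) % 4 = d)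
    (hA0 : 1 ≤ (cls A 0).card) (hB : 1 ≤ (cls B s).card) (hBB : (cls B s).card = (cls B t).card)
    (hAA : (cls A 0).card = (cls A 2).card) :
    2 * ((cls B s).card + (cls A 0).card) ≤ (cls (B + A) c).card + (cls (B + A) d).card + 1 := by
  by_contra hcon
  have hBt : 1 ≤ (cls B t).card := by omega
  have hA2 : 1 ≤ (cls A 2).card := by omega
  have l1 := cls_lower B A s 0 c h1 hA0 hB
  have l2 := cls_lower B A s 2 d h3 hA2 hB
  have e1 := cls_eq B A s 0 c h1 hA0 hB (by omega)
  have e2 := cls_eq B A t 2 c h2 hA2 hBt (by omega)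
  have e3 := cls_eq B A s 2 d h3 hA2 hB (by omega)
  have e4 := cls_eq B A t 0 d h4 hA0 hBt (by omega)
  have nA0 := Finset.card_pos.1 hA0
  have nA2 := Finset.card_pos.1 hA2
  have nBs := Finset.card_pos.1 hB
  have nBt := Finset.card_pos.1 hBt
  have m1 := min_add_eq nBs nA0 nBt nA2 (e1.trans e2.symm)
  have m2 := min_add_eq nBs nA2 nBt nA0 (e3.trans e4.symm)
  have r1 := min_mod nBs
  have r2 := min_mod nBt
  omega

theorem cyc_lower (B A : Finset ℤ) (i j k0 k1 k2 k3 : ℤ) (hij : i ≠ j)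
    (g0 : (0 + j) % 4 = k0) (g1 : (1 + j) % 4 = k1) (g2 : (2 + j) % 4 = k2) (g3 : (3 + j) % 4 = k3)
    (f0 : (1 + i) % 4 = k0) (f1 : (2 + i) % 4 = k1) (f2 : (3 + i) % 4 = k2) (f3 : (0 + i) % 4 = k3)
    (hA : 1 ≤ (cls A i).card) (hAA : (cls A i).card = (cls A j).card)
    (b0 : (cls B 0).card = 1) (b1 : (cls B 1).card = 1) (b2 : (cls B 2).card = 1)
    (b3 : (cls B 3).card = 1) :
    4 * (cls A i).card + 1 ≤ (cls (B + A) k0).card + (cls (B + A) k1).card +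
      (cls (B + A) k2).card + (cls (B + A) k3).card := by
  by_contra hcon
  have hAj : 1 ≤ (cls A j).card := by omega
  have l0 := cls_lower B A 0 j k0 g0 hAj b0.ge
  have l1 := cls_lower B A 1 j k1 g1 hAj b1.ge
  have l2 := cls_lower B A 2 j k2 g2 hAj b2.ge
  have l3 := cls_lower B A 3 j k3 g3 hAj b3.ge
  have p0 := cls_eq B A 0 j k0 g0 hAj b0.ge (by omega)
  have p1 := cls_eq B A 1 j k1 g1 hAj b1.ge (by omega)
  have p2 := cls_eq B A 2 j k2 g2 hAj b2.ge (by omega)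
  have p3 := cls_eq B A 3 j k3 g3 hAj b3.ge (by omega)
  have q0 := cls_eq B A 1 i k0 f0 hA b1.ge (by omega)
  have q1 := cls_eq B A 2 i k1 f1 hA b2.ge (by omega)
  have q2 := cls_eq B A 3 i k2 f2 hA b3.ge (by omega)
  have q3 := cls_eq B A 0 i k3 f3 hA b0.ge (by omega)
  have nAi := Finset.card_pos.1 hA
  have nAj := Finset.card_pos.1 hAj
  have n0 := Finset.card_pos.1 b0.ge
  have n1 := Finset.card_pos.1 b1.ge
  have n2 := Finset.card_pos.1 b2.ge
  have n3 := Finset.card_pos.1 b3.ge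
  have m0 := min_add_eq n0 nAj n1 nAi (p0.trans q0.symm)
  have m1 := min_add_eq n1 nAj n2 nAi (p1.trans q1.symm)
  have m2 := min_add_eq n2 nAj n3 nAi (p2.trans q2.symm)
  have m3 := min_add_eq n3 nAj n0 nAi (p3.trans q3.symm)
  have r1 := min_mod nAi
  have r2 := min_mod nAj
  omega

/-- Key estimate for one residue class. -/
theorem key (B A : Finset ℤ) (hx : 1 ≤ (cls A 0).card) (hy : 1 ≤ (cls A 1).card)
    (hz : 1 ≤ (cls A 2).card) (h3 : (cls A 3).card = 0) (hn : 5 ≤ A.card)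
    (hm : (cls A 0).card ≤ 4 ∨ (cls A 1).card ≤ 4 ∨ (cls A 2).card ≤ 4)
    (ht : B.card = (cls A 0).card ∨ B.card = (cls A 1).card ∨ B.card = (cls A 2).card) :
    A.card + 2 * B.card ≤ (B + A).card + 2 := by
  have eA := card_cls A
  have eB := card_cls B
  have eS := card_cls (B + A)
  rw [h3, add_zero] at eA
  rw [← eA] at hn
  rw [← eB] at ht
  rw [← eA, ← eB, ← eS]
  refine arith_all _ _ _ _ _ _ _ _ _ _ _ hx hy hz hn hm ht
    (cls_lower B A 0 0 0 (by norm_num) hx) (cls_lower B A 0 1 1 (by norm_num) hy)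
    (cls_lower B A 0 2 2 (by norm_num) hz)
    (cls_lower B A 1 0 1 (by norm_num) hx) (cls_lower B A 1 1 2 (by norm_num) hy)
    (cls_lower B A 1 2 3 (by norm_num) hz)
    (cls_lower B A 2 0 2 (by norm_num) hx) (cls_lower B A 2 1 3 (by norm_num) hy)
    (cls_lower B A 2 2 0 (by norm_num) hz)
    (cls_lower B A 3 0 3 (by norm_num) hx) (cls_lower B A 3 1 0 (by norm_num) hy)
    (cls_lower B A 3 2 1 (by norm_num) hz)
    (fun h e e' => swap_lower B A 0 2 0 2 (by norm_num) (by norm_num) (by norm_num) (by norm_num)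
      (by norm_num) hx h e e')
    (fun h e e' => swap_lower B A 1 3 1 3 (by norm_num) (by norm_num) (by norm_num) (by norm_num)
      (by norm_num) hx h e e') ?_ ?_
  · intro b0 b1 b2 b3 e
    have := cyc_lower B A 0 1 1 2 3 0 (by norm_num) (by norm_num) (by norm_num) (by norm_num)
      (by norm_num) (by norm_num) (by norm_num) (by norm_num) (by norm_num) hx e b0 b1 b2 b3
    omega
  · intro b0 b1 b2 b3 e
    have := cyc_lower B A 1 2 2 3 0 1 (by norm_num) (by norm_num) (by norm_num) (by norm_num)
      (by norm_num) (by norm_num) (by norm_num) (by norm_num) (by norm_num) hy e b0 b1 b2 b3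
    omega

/-- the quotient set of a residue class -/
def quo (A : Finset ℤ) (c : ℤ) : Finset ℤ := (cls A c).image (fun a => a / 4)

theorem card_quo (A : Finset ℤ) (c : ℤ) : (quo A c).card = (cls A c).card := by
  apply Finset.card_image_of_injOn
  intro a ha b hb e
  have ha := (mem_cls.1 (Finset.mem_coe.1 ha)).2
  have hb := (mem_cls.1 (Finset.mem_coe.1 hb)).2
  dsimp at e
  omega

theorem card_cls_sum (A : Finset ℤ) (c : ℤ) :
    (quo A c + A).card ≤ (cls (A + A.image (fun b => (4 : ℤ) * b)) c).card := by
  apply Finset.card_le_card_of_injOn (fun x => 4 * x + c)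
  · intro x hx
    obtain ⟨q, hq, a, ha, rfl⟩ := Finset.mem_add.1 (Finset.mem_coe.1 hx)
    obtain ⟨b, hb, rfl⟩ := Finset.mem_image.1 hq
    obtain ⟨hb, hbc⟩ := mem_cls.1 hb
    refine Finset.mem_coe.2 (mem_cls.2 ⟨Finset.mem_add.2 ⟨b, hb, 4 * a,
      Finset.mem_image_of_mem _ ha, by dsimp only; omega⟩, by dsimp only; omega⟩)
  · intro a _ b _ e
    dsimp at e
    omega

theorem main_norm (A : Finset ℤ) (hx : 1 ≤ (cls A 0).card) (hy : 1 ≤ (cls A 1).card)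
    (hz : 1 ≤ (cls A 2).card) (h3 : (cls A 3).card = 0) (hn : 5 ≤ A.card)
    (hm : (cls A 0).card ≤ 4 ∨ (cls A 1).card ≤ 4 ∨ (cls A 2).card ≤ 4) :
    5 * A.card ≤ (A + A.image (fun b => (4 : ℤ) * b)).card + 6 := by
  have k0 := key (quo A 0) A hx hy hz h3 hn hm (Or.inl (card_quo A 0))
  have k1 := key (quo A 1) A hx hy hz h3 hn hm (Or.inr (Or.inl (card_quo A 1)))
  have k2 := key (quo A 2) A hx hy hz h3 hn hm (Or.inr (Or.inr (card_quo A 2)))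
  have d0 := card_cls_sum A 0
  have d1 := card_cls_sum A 1
  have d2 := card_cls_sum A 2
  have eA := card_cls A
  have eS := card_cls (A + A.image (fun b => (4 : ℤ) * b))
  rw [card_quo] at k0 k1 k2
  omega

theorem card_cls_shift (A : Finset ℤ) (t c d : ℤ) (h : (c + t) % 4 = d) (hc : c % 4 = c) :
    (cls (A.image (fun a => a + t)) d).card = (cls A c).card := by
  have : cls (A.image (fun a => a + t)) d = (cls A c).image (fun a => a + t) := by
    ext x
    simp only [mem_cls, Finset.mem_image]
    constructor
    · rintro ⟨⟨a, ha, rfl⟩, hx⟩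
      exact ⟨a, ⟨ha, by omega⟩, rfl⟩
    · rintro ⟨a, ⟨ha, hac⟩, rfl⟩
      exact ⟨⟨a, ha, rfl⟩, by omega⟩
  rw [this, Finset.card_image_of_injective _ (add_left_injective t)]

theorem main_shift (A : Finset ℤ) (t p q r m : ℤ) (hp : (p + t) % 4 = 0) (hq : (q + t) % 4 = 1)
    (hr : (r + t) % 4 = 2) (hm' : (m + t) % 4 = 3) (hp' : p % 4 = p) (hq' : q % 4 = q)
    (hr' : r % 4 = r) (hmm : m % 4 = m)
    (hx : 1 ≤ (cls A p).card) (hy : 1 ≤ (cls A q).card)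
    (hz : 1 ≤ (cls A r).card) (h3 : (cls A m).card = 0) (hn : 5 ≤ A.card)
    (hm : (cls A p).card ≤ 4 ∨ (cls A q).card ≤ 4 ∨ (cls A r).card ≤ 4) :
    5 * A.card ≤ (A + A.image (fun b => (4 : ℤ) * b)).card + 6 := by
  have e0 := card_cls_shift A t p 0 hp hp'
  have e1 := card_cls_shift A t q 1 hq hq'
  have e2 := card_cls_shift A t r 2 hr hr'
  have e3 := card_cls_shift A t m 3 hm' hmm
  have ec : (A.image (fun a => a + t)).card = A.card :=
    Finset.card_image_of_injective _ (add_left_injective t)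
  have es : (A.image (fun a => a + t)) + (A.image (fun a => a + t)).image (fun b => (4 : ℤ) * b) =
      (A + A.image (fun b => (4 : ℤ) * b)).image (fun a => a + 5 * t) := by
    ext x
    simp only [Finset.mem_add, Finset.mem_image]
    constructor
    · rintro ⟨_, ⟨a, ha, rfl⟩, _, ⟨_, ⟨b, hb, rfl⟩, rfl⟩, rfl⟩
      exact ⟨a + 4 * b, ⟨a, ha, 4 * b, ⟨b, hb, rfl⟩, rfl⟩, by ring⟩
    · rintro ⟨_, ⟨a, ha, _, ⟨b, hb, rfl⟩, rfl⟩, rfl⟩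
      exact ⟨a + t, ⟨a, ha, rfl⟩, 4 * (b + t), ⟨b + t, ⟨b, hb, rfl⟩, rfl⟩, by ring⟩
  have := main_norm (A.image (fun a => a + t)) (by rw [e0]; exact hx) (by rw [e1]; exact hy)
    (by rw [e2]; exact hz) (by rw [e3]; exact h3) (by rw [ec]; exact hn)
    (by rw [e0, e1, e2]; exact hm)
  rwa [es, ec, Finset.card_image_of_injective _ (add_left_injective (5 * t))] at this

theorem main_any (A : Finset ℤ) (hn : 5 ≤ A.card) (u₁ u₂ u₃ : ℤ) (h12 : u₁ ≠ u₂) (h13 : u₁ ≠ u₃)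
    (h23 : u₂ ≠ u₃) (himg : A.image (fun a => a % 4) = {u₁, u₂, u₃})
    (h4 : (cls A u₃).card ≤ 4) :
    5 * A.card ≤ (A + A.image (fun b => (4 : ℤ) * b)).card + 6 := by
  have hpos : ∀ c : ℤ, c ∈ A.image (fun a => a % 4) → 1 ≤ (cls A c).card ∧ 0 ≤ c ∧ c < 4 := by
    intro c hc
    obtain ⟨a, ha, rfl⟩ := Finset.mem_image.1 hc
    exact ⟨Finset.card_pos.2 ⟨a, mem_cls.2 ⟨ha, rfl⟩⟩, by omega, by omega⟩
  have hzero : ∀ c : ℤ, c ∉ A.image (fun a => a % 4) → (cls A c).card = 0 := by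
    intro c hc
    rw [Finset.card_eq_zero, Finset.eq_empty_iff_forall_notMem]
    intro a ha
    obtain ⟨haA, rfl⟩ := mem_cls.1 ha
    exact hc (Finset.mem_image_of_mem (fun a : ℤ => a % 4) haA)
  rw [himg] at hpos hzero
  obtain ⟨p1, l1, g1⟩ := hpos u₁ (by simp)
  obtain ⟨p2, l2, g2⟩ := hpos u₂ (by simp)
  obtain ⟨p3, l3, g3⟩ := hpos u₃ (by simp)
  have z : ∀ c : ℤ, c ≠ u₁ → c ≠ u₂ → c ≠ u₃ → (cls A c).card = 0 := by
    intro c a b d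
    exact hzero c (by simp [a, b, d])
  have pos : ∀ c : ℤ, c = u₁ ∨ c = u₂ ∨ c = u₃ → 1 ≤ (cls A c).card := by
    rintro c (rfl | rfl | rfl) <;> assumption
  have small : ∀ c : ℤ, u₃ = c → (cls A c).card ≤ 4 := by
    rintro c rfl
    exact h4
  have hmiss : (0 ≠ u₁ ∧ 0 ≠ u₂ ∧ 0 ≠ u₃) ∨ (1 ≠ u₁ ∧ 1 ≠ u₂ ∧ 1 ≠ u₃) ∨
      (2 ≠ u₁ ∧ 2 ≠ u₂ ∧ 2 ≠ u₃) ∨ (3 ≠ u₁ ∧ 3 ≠ u₂ ∧ 3 ≠ u₃) := by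
    omega
  rcases hmiss with ⟨a, b, d⟩ | ⟨a, b, d⟩ | ⟨a, b, d⟩ | ⟨a, b, d⟩
  · have hu : u₃ = 1 ∨ u₃ = 2 ∨ u₃ = 3 := by
      omega
    exact main_shift A 3 1 2 3 0 (by norm_num) (by norm_num) (by norm_num) (by norm_num)
      (by norm_num) (by norm_num) (by norm_num) (by norm_num)
      (pos 1 (by omega)) (pos 2 (by omega)) (pos 3 (by omega)) (z 0 a b d) hn
      (hu.imp (small 1) (Or.imp (small 2) (small 3)))
  · have hu : u₃ = 2 ∨ u₃ = 3 ∨ u₃ = 0 := by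
      omega
    exact main_shift A 2 2 3 0 1 (by norm_num) (by norm_num) (by norm_num) (by norm_num)
      (by norm_num) (by norm_num) (by norm_num) (by norm_num)
      (pos 2 (by omega)) (pos 3 (by omega)) (pos 0 (by omega)) (z 1 a b d) hn
      (hu.imp (small 2) (Or.imp (small 3) (small 0)))
  · have hu : u₃ = 3 ∨ u₃ = 0 ∨ u₃ = 1 := by
      omega
    exact main_shift A 1 3 0 1 2 (by norm_num) (by norm_num) (by norm_num) (by norm_num)
      (by norm_num) (by norm_num) (by norm_num) (by norm_num)
      (pos 3 (by omega)) (pos 0 (by omega)) (pos 1 (by omega)) (z 2 a b d) hn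
      (hu.imp (small 3) (Or.imp (small 0) (small 1)))
  · have hu : u₃ = 0 ∨ u₃ = 1 ∨ u₃ = 2 := by
      omega
    exact main_shift A 0 0 1 2 3 (by norm_num) (by norm_num) (by norm_num) (by norm_num)
      (by norm_num) (by norm_num) (by norm_num) (by norm_num)
      (pos 0 (by omega)) (pos 1 (by omega)) (pos 2 (by omega)) (z 3 a b d) hn
      (hu.imp (small 0) (Or.imp (small 1) (small 2)))

/-- Let `A` be a finite set of integers with `|A| ≥ 5` attaining exactly 3 distinct residues
`u₁, u₂, u₃` modulo 4, with residue classes ordered so that `|A₁| ≥ |A₂| ≥ |A₃|`.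
If `|A₃| ≤ 4`, then `|A + 4·A| ≥ 5|A| − 6`. -/
theorem stmt_18 (A : Finset ℤ) (hA : 5 ≤ A.card)
    (u₁ u₂ u₃ : ℤ) (h12 : u₁ ≠ u₂) (h13 : u₁ ≠ u₃) (h23 : u₂ ≠ u₃)
    (himg : A.image (fun a => a % 4) = {u₁, u₂, u₃})
    (hord1 : (A.filter (fun a => a % 4 = u₂)).card ≤ (A.filter (fun a => a % 4 = u₁)).card)
    (hord2 : (A.filter (fun a => a % 4 = u₃)).card ≤ (A.filter (fun a => a % 4 = u₂)).card)
    (h4 : (A.filter (fun a => a % 4 = u₃)).card ≤ 4) :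
    (5 : ℤ) * A.card - 6 ≤ ((A + A.image (fun b => (4 : ℤ) * b)).card : ℤ) := by
  have h := main_any A hA u₁ u₂ u₃ h12 h13 h23 himg h4
  have h' : (5 : ℤ) * A.card ≤ ((A + A.image (fun b => (4 : ℤ) * b)).card : ℤ) + 6 := by
    exact_mod_cast h
  linarith
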